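/- Let G1 be a DAG and let G2 be the directed graph obtained from G1 by reversing a single edge that is isolated in G1 (so G2 is also a DAG). Then for every single-node hard intervention target I1 there exists a single-node hard intervention target I2 such that 𝒯(G1^(I1)) = 𝒯(G2^(I2)). -/

import Mathlib

universe u

/-- Acyclicity of a directed graph given by its edge relation. -/
def IsDAG {V : Type u} (E : V → V → Prop) : Prop :=
  ∀ v : V, ¬ Relation.TransGen E v v

/-- Hard intervention with target set `I`: delete every edge whose head lies in `I`. -/
def intervene {V : Type u} (E : V → V → Prop) (I : Set V) : V → V → Prop :=
  fun u v => E u v ∧ v ∉ I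

/-- Activity condition at an interior vertex `v` of a path, with neighbours `u` and `w`:
if `v` is a collider (both path edges point into `v`) then `v` or one of its directed
descendants must lie in `C`; otherwise `v` must not lie in `C`. -/
def ActiveTriple {V : Type u} (E : V → V → Prop) (C : Set V) (u v w : V) : Prop :=
  ((E u v ∧ E w v) → ∃ d, Relation.ReflTransGen E v d ∧ d ∈ C) ∧
  (¬ (E u v ∧ E w v) → v ∉ C)

/-- Every interior vertex of the vertex list satisfies the activity condition. -/
def TriplesActive {V : Type u} (E : V → V → Prop) (C : Set V) : List V → Prop
  | u :: v :: w :: rest => ActiveTriple E C u v w ∧ TriplesActive E C (v :: w :: rest)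
  | _ => True

/-- `p` is an active path between `a` and `b` given the conditioning set `C`. -/
def IsActivePath {V : Type u} (E : V → V → Prop) (C : Set V) (p : List V) (a b : V) : Prop :=
  p.Nodup ∧ p.head? = some a ∧ p.getLast? = some b ∧
  List.Chain' (fun u v => E u v ∨ E v u) p ∧ TriplesActive E C p

/-- Two single vertices are d-connected given `C`. -/
def dconn {V : Type u} (E : V → V → Prop) (C : Set V) (a b : V) : Prop :=
  ∃ p : List V, IsActivePath E C p a b

/-- Two single vertices are d-separated given `C`. -/
def dsepV {V : Type u} (E : V → V → Prop) (C : Set V) (a b : V) : Prop :=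
  ¬ dconn E C a b

/-- Vertex sets `A` and `B` are d-separated given `C`. -/
def dsep {V : Type u} (E : V → V → Prop) (A B C : Set V) : Prop :=
  ∀ a ∈ A, ∀ b ∈ B, dsepV E C a b

/-- `𝒯(G)`: the set of d-separation triples of pairwise disjoint vertex sets. -/
def Tsep {V : Type u} (E : V → V → Prop) : Set (Set V × Set V × Set V) :=
  { t | Disjoint t.1 t.2.1 ∧ Disjoint t.1 t.2.2 ∧ Disjoint t.2.1 t.2.2 ∧
        dsep E t.1 t.2.1 t.2.2 }

/-- An edge `u → v` is isolated: `u` has no parents and the only parent of `v` is `u`. -/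
def IsolatedEdge {V : Type u} (E : V → V → Prop) (u v : V) : Prop :=
  E u v ∧ (∀ w, ¬ E w u) ∧ (∀ w, E w v → w = u)

/-- The graph obtained by reversing the edge `u → v`. -/
def reverseEdge {V : Type u} (E : V → V → Prop) (u v : V) : V → V → Prop :=
  fun a b => (E a b ∧ ¬ (a = u ∧ b = v)) ∨ (a = v ∧ b = u)

/-- One step of isolated-edge reversal between DAGs. -/
def IsoStep {V : Type u} (E₁ E₂ : V → V → Prop) : Prop :=
  IsDAG E₁ ∧ IsDAG E₂ ∧ ∃ u v, IsolatedEdge E₁ u v ∧ E₂ = reverseEdge E₁ u v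

/-- Isolated equivalence: a finite sequence of isolated-edge reversals,
each intermediate graph being a DAG. -/
def IsoEquiv {V : Type u} (E₁ E₂ : V → V → Prop) : Prop :=
  Relation.ReflTransGen IsoStep E₁ E₂

/-- An edge `u → v` is covered: `pa(v) = pa(u) ∪ {u}`. -/
def CoveredEdge {V : Type u} (E : V → V → Prop) (u v : V) : Prop :=
  E u v ∧ ∀ w, E w v ↔ (E w u ∨ w = u)

/-- `p` is a directed path from `a` to `b`. -/
def IsDirPath {V : Type u} (E : V → V → Prop) (p : List V) (a b : V) : Prop :=
  p.Nodup ∧ p.head? = some a ∧ p.getLast? = some b ∧ List.Chain' E p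

/-- A measurement model on observed vertices `Xs` and hidden vertices `Hs`:
a DAG in which every edge goes from a hidden vertex to an observed or hidden one
(so observed vertices have no outgoing edges and all their parents are hidden). -/
def IsMeasurementModel {V : Type u} (E : V → V → Prop) (Xs Hs : Set V) : Prop :=
  IsDAG E ∧ Disjoint Xs Hs ∧ ∀ u v, E u v → u ∈ Hs ∧ (v ∈ Xs ∨ v ∈ Hs)

/-- Observed children of a hidden vertex. -/
def chSet {V : Type u} (E : V → V → Prop) (Xs : Set V) (h : V) : Set V :=
  {x | x ∈ Xs ∧ E h x}

/-- Undirected dependency graph on `Xs`: distinct observed vertices are adjacent iff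
they are d-connected given the empty set. -/
def UDG {V : Type u} (E : V → V → Prop) (Xs : Set V) : V → V → Prop :=
  fun x x' => x ∈ Xs ∧ x' ∈ Xs ∧ x ≠ x' ∧ dconn E ∅ x x'

/-- `C` is a clique of the undirected graph `R` on vertex set `Xs`. -/
def IsCliqueIn {V : Type u} (R : V → V → Prop) (Xs C : Set V) : Prop :=
  C ⊆ Xs ∧ ∀ x ∈ C, ∀ y ∈ C, x ≠ y → R x y

/-- `C` is an inclusion-maximal clique of `R` on `Xs`. -/
def IsMaxCliqueIn {V : Type u} (R : V → V → Prop) (Xs C : Set V) : Prop :=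
  IsCliqueIn R Xs C ∧ ∀ C', IsCliqueIn R Xs C' → C ⊆ C' → C = C'

/-- The complete family of intervention targets `𝓘 = {∅} ∪ {{h} : h ∈ H}`. -/
def completeFamily {V : Type u} (Hs : Set V) : Set (Set V) :=
  insert ∅ ((fun h => ({h} : Set V)) '' Hs)

/-- `Ω_G^(I)`: the set of maximal cliques of `UDG(G^(I))`. -/
def maxCliques {V : Type u} (E : V → V → Prop) (Xs I : Set V) : Set (Set V) :=
  {C | IsMaxCliqueIn (UDG (intervene E I) Xs) Xs C}

/-- `Ω = ⋃_{I ∈ 𝓘} Ω_G^(I)`. -/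
def Omega {V : Type u} (E : V → V → Prop) (Xs Hs : Set V) : Set (Set V) :=
  ⋃ I ∈ completeFamily Hs, maxCliques E Xs I

/-- A valid subset of the observed vertices. -/
def ValidSubset {V : Type u} (E : V → V → Prop) (Xs Hs X' : Set V) : Prop :=
  X' ⊆ Xs ∧ ∀ I ∈ completeFamily Hs, ∃ C ∈ maxCliques E Xs I, X' ⊆ C

/-- A maximal valid subset. -/
def MaxValidSubset {V : Type u} (E : V → V → Prop) (Xs Hs X' : Set V) : Prop :=
  ValidSubset E Xs Hs X' ∧
  ¬ ∃ X'', ValidSubset E Xs Hs X'' ∧ X' ⊂ X'' ∧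
      ∀ C ∈ Omega E Xs Hs, X' ⊆ C → X'' ⊆ C

/-- An imaginary subset: a maximal valid subset not contained in the child set of
any hidden vertex. -/
def ImaginarySubset {V : Type u} (E : V → V → Prop) (Xs Hs X' : Set V) : Prop :=
  MaxValidSubset E Xs Hs X' ∧ ¬ ∃ h ∈ Hs, X' ⊆ chSet E Xs h

/-- A replaceable subset: a maximal valid subset strictly contained in another
maximal valid subset. -/
def ReplaceableSubset {V : Type u} (E : V → V → Prop) (Xs Hs X' : Set V) : Prop :=
  MaxValidSubset E Xs Hs X' ∧ ∃ X'', MaxValidSubset E Xs Hs X'' ∧ X' ⊂ X''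

/-- Graphical condition (c). -/
def CondC {V : Type u} (E : V → V → Prop) (Xs Hs : Set V) : Prop :=
  ∀ I ∈ completeFamily Hs, ∀ h ∈ Hs, ∀ h' ∈ Hs, h ≠ h' →
    dsepV (intervene E I) ∅ h h' →
    ∃ x ∈ chSet E Xs h, ∃ x' ∈ chSet E Xs h', dsepV (intervene E I) ∅ x x'

/-- Add an edge `a → b` to a graph. -/
def addEdge {V : Type u} (E : V → V → Prop) (a b : V) : V → V → Prop :=
  fun u v => E u v ∨ (u = a ∧ v = b)

/-- Graphical maximality of a measurement model. -/
def GraphMaximal {V : Type u} (E : V → V → Prop) (Xs Hs : Set V) : Prop :=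
  (∀ x ∈ Xs, ∃ v, E v x) ∧
  ∀ h ∈ Hs, ∀ x ∈ Xs, ¬ E h x →
    ∃ I ∈ completeFamily Hs,
      UDG (intervene (addEdge E h x) I) Xs ≠ UDG (intervene E I) Xs

/-- A clique `C` is shattered by a collection `S` if some subcollection of `S`
has union exactly `C`. -/
def Shattered {V : Type u} (S : Set (Set V)) (C : Set V) : Prop :=
  ∃ S' ⊆ S, C = ⋃₀ S'

/-- A complete collection of maximal valid subsets: for every intervention target,
every edge of the UDG has both endpoints in some shattered maximal clique. -/
def CompleteCollection {V : Type u} (E : V → V → Prop) (Xs Hs : Set V)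
    (S : Set (Set V)) : Prop :=
  (∀ s ∈ S, MaxValidSubset E Xs Hs s) ∧
  ∀ I ∈ completeFamily Hs, ∀ x x' : V, UDG (intervene E I) Xs x x' →
    ∃ C ∈ maxCliques E Xs I, x ∈ C ∧ x' ∈ C ∧ Shattered S C

/-- A fractured subset. -/
def FracturedSubset {V : Type u} (E : V → V → Prop) (Xs Hs X' : Set V) : Prop :=
  MaxValidSubset E Xs Hs X' ∧
  ∃ S, CompleteCollection E Xs Hs S ∧ ∀ s ∈ S, ¬ s ⊆ X'

/-- The pure-child assumption. -/
def PureChild {V : Type u} (E : V → V → Prop) (Xs Hs : Set V) : Prop :=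
  ∀ h ∈ Hs, ∃ x ∈ Xs, E h x ∧ ∀ w, E w x → w = h

/-- The latent DAG: the induced directed graph on the hidden vertices. -/
def latentGraph {V : Type u} (E : V → V → Prop) (Hs : Set V) : V → V → Prop :=
  fun u v => u ∈ Hs ∧ v ∈ Hs ∧ E u v

/-- A common-parent path `x1 ← h → x2`. -/
def IsCPPath {V : Type u} (p : List V) (x1 x2 : V) : Prop :=
  ∃ h, p = [x1, h, x2]

/-- A sparse measurement model. -/
def SparseMM {V : Type u} (E : V → V → Prop) (Xs Hs : Set V) : Prop :=
  (∀ x1 ∈ Xs, ∀ x2 ∈ Xs, x1 ≠ x2 → dconn E ∅ x1 x2 →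
    (∀ h ∈ Hs, ∀ h' ∈ Hs,
        x1 ∈ chSet E Xs h → x2 ∈ chSet E Xs h →
        x1 ∈ chSet E Xs h' → x2 ∈ chSet E Xs h' → h = h') ∧
    (∀ p q : List V,
        IsActivePath E ∅ p x1 x2 → ¬ IsCPPath p x1 x2 →
        IsActivePath E ∅ q x1 x2 → ¬ IsCPPath q x1 x2 → p = q)) ∧
  (∀ x1 ∈ Xs, ∀ x2 ∈ Xs, ∀ x3 ∈ Xs, ∀ h2 ∈ Hs, ∀ h3 ∈ Hs, h2 ≠ h3 →
    x1 ∈ chSet E Xs h2 → x2 ∈ chSet E Xs h2 →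
    x1 ∈ chSet E Xs h3 → x3 ∈ chSet E Xs h3 →
    ∀ p : List V, IsActivePath E ∅ p x2 x3 →
      ¬ IsCPPath p x2 x3 ∧ p[1]? = some h2 ∧ p.reverse[1]? = some h3)

section IsolatedEdge

variable {V : Type u} {E : V → V → Prop} {u v : V}

theorem IsolatedEdge.ne (h : IsolatedEdge E u v) : u ≠ v := by
  rintro rfl
  exact h.2.1 u h.1

theorem IsolatedEdge.reverseEdge (h : IsolatedEdge E u v) :
    IsolatedEdge (reverseEdge E u v) v u := by
  refine ⟨Or.inr ⟨rfl, rfl⟩, ?_, ?_⟩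
  · rintro w (⟨hw, hn⟩ | ⟨-, hvu⟩)
    · exact hn ⟨h.2.2 w hw, rfl⟩
    · exact h.ne hvu.symm
  · rintro w (⟨hw, -⟩ | ⟨hw, -⟩)
    · exact absurd hw (h.2.1 w)
    · exact hw

theorem IsolatedEdge.reverseEdge_reverseEdge (h : IsolatedEdge E u v) :
    _root_.reverseEdge (_root_.reverseEdge E u v) v u = E := by
  funext a b
  apply propext
  constructor
  · rintro (⟨⟨hab, -⟩ | hab, hn⟩ | ⟨rfl, rfl⟩)
    · exact hab
    · exact absurd hab hn
    · exact h.1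
  · intro hab
    by_cases hc : a = u ∧ b = v
    · exact Or.inr hc
    · refine Or.inl ⟨Or.inl ⟨hab, hc⟩, ?_⟩
      rintro ⟨-, rfl⟩
      exact h.2.1 a hab

theorem reverseEdge_iff_of_ne {a b : V} (hu : b ≠ u) (hv : b ≠ v) :
    reverseEdge E u v a b ↔ E a b := by
  simp [reverseEdge, hu, hv]

theorem IsolatedEdge.reflTransGen_reverseEdge (h : IsolatedEdge E u v) {a b : V}
    (hu : a ≠ u) (hv : a ≠ v) (hab : Relation.ReflTransGen E a b) :
    Relation.ReflTransGen (_root_.reverseEdge E u v) a b := by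
  suffices H : Relation.ReflTransGen (_root_.reverseEdge E u v) a b ∧ b ≠ u ∧ b ≠ v from H.1
  induction hab with
  | refl => exact ⟨.refl, hu, hv⟩
  | @tail b c _ hbc ih =>
    have hcu : c ≠ u := by
      rintro rfl
      exact h.2.1 b hbc
    have hcv : c ≠ v := by
      rintro rfl
      exact ih.2.1 (h.2.2 b hbc)
    exact ⟨ih.1.tail ((reverseEdge_iff_of_ne hcu hcv).2 hbc), hcu, hcv⟩

theorem IsolatedEdge.not_collider (h : IsolatedEdge E u v) {a b c : V} (hac : a ≠ c)
    (hb : b = u ∨ b = v) : ¬ (E a b ∧ E c b) := by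
  rintro ⟨hab, hcb⟩
  rcases hb with rfl | rfl
  · exact h.2.1 a hab
  · exact hac ((h.2.2 a hab).trans (h.2.2 c hcb).symm)

theorem IsolatedEdge.activeTriple_reverseEdge (h : IsolatedEdge E u v) {C : Set V} {a b c : V}
    (hac : a ≠ c) (ht : ActiveTriple E C a b c) :
    ActiveTriple (_root_.reverseEdge E u v) C a b c := by
  by_cases hb : b = u ∨ b = v
  · exact ⟨fun hc => absurd hc (h.reverseEdge.not_collider hac hb.symm),
      fun _ => ht.2 (h.not_collider hac hb)⟩
  · push Not at hb
    simp only [ActiveTriple, reverseEdge_iff_of_ne hb.1 hb.2]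
    refine ⟨fun hc => ?_, ht.2⟩
    obtain ⟨d, hd, hdC⟩ := ht.1 hc
    exact ⟨d, h.reflTransGen_reverseEdge hb.1 hb.2 hd, hdC⟩

theorem IsolatedEdge.triplesActive_reverseEdge (h : IsolatedEdge E u v) {C : Set V} :
    ∀ {p : List V}, p.Nodup → TriplesActive E C p →
      TriplesActive (_root_.reverseEdge E u v) C p
  | [], _, _ => trivial
  | [_], _, _ => trivial
  | [_, _], _, _ => trivial
  | a :: b :: c :: rest, hp, ht => by
    refine ⟨h.activeTriple_reverseEdge ?_ ht.1, h.triplesActive_reverseEdge hp.of_cons ht.2⟩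
    rintro rfl
    simp at hp

theorem reverseEdge_adj {a b : V} (hab : E a b ∨ E b a) :
    reverseEdge E u v a b ∨ reverseEdge E u v b a := by
  unfold reverseEdge
  tauto

theorem IsolatedEdge.dconn_reverseEdge (h : IsolatedEdge E u v) {C : Set V} {a b : V}
    (hab : dconn E C a b) : dconn (_root_.reverseEdge E u v) C a b := by
  obtain ⟨p, hp, ha, hb, hc, ht⟩ := hab
  exact ⟨p, hp, ha, hb, hc.imp fun _ _ => reverseEdge_adj, h.triplesActive_reverseEdge hp ht⟩

theorem IsolatedEdge.dconn_reverseEdge_iff (h : IsolatedEdge E u v) {C : Set V} {a b : V} :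
    dconn (_root_.reverseEdge E u v) C a b ↔ dconn E C a b := by
  refine ⟨fun hab => ?_, h.dconn_reverseEdge⟩
  have := h.reverseEdge.dconn_reverseEdge hab
  rwa [h.reverseEdge_reverseEdge] at this

theorem IsolatedEdge.Tsep_reverseEdge (h : IsolatedEdge E u v) :
    Tsep (_root_.reverseEdge E u v) = Tsep E := by
  simp only [Tsep, dsep, dsepV, h.dconn_reverseEdge_iff]

theorem intervene_empty : intervene E ∅ = E := by
  funext a b
  simp [intervene]

theorem IsolatedEdge.intervene_tail (h : IsolatedEdge E u v) : intervene E {u} = E := by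
  funext a b
  simp only [intervene, Set.mem_singleton_iff, eq_iff_iff, and_iff_left_iff_imp]
  rintro hab rfl
  exact h.2.1 a hab

theorem IsolatedEdge.intervene_head (h : IsolatedEdge E u v) :
    intervene E {v} = intervene (_root_.reverseEdge E u v) {u} := by
  have hu := h.2.1
  have hv := h.2.2
  funext a b
  apply propext
  simp only [intervene, Set.mem_singleton_iff, _root_.reverseEdge]
  grind

theorem IsolatedEdge.intervene (h : IsolatedEdge E u v) {I : Set V} (hv : v ∉ I) :
    IsolatedEdge (intervene E I) u v :=
  ⟨⟨h.1, hv⟩, fun w hw => h.2.1 w hw.1, fun w hw => h.2.2 w hw.1⟩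

theorem intervene_reverseEdge {I : Set V} (hu : u ∉ I) :
    intervene (reverseEdge E u v) I = reverseEdge (intervene E I) u v := by
  funext a b
  apply propext
  simp only [intervene, reverseEdge]
  grind

end IsolatedEdge

/-- If `G2` is obtained from a DAG `G1` by reversing a single isolated
edge, then for every single-node hard intervention target `I1` there is a single-node hard
intervention target `I2` with `𝒯(G1^(I1)) = 𝒯(G2^(I2))`. -/
theorem statement2 {V : Type u} [Fintype V] (E1 : V → V → Prop) (u v : V)
    (hd1 : IsDAG E1) (hiso : IsolatedEdge E1 u v) :
    ∀ I1 : Set V, I1.Subsingleton →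
      ∃ I2 : Set V, I2.Subsingleton ∧
        Tsep (intervene E1 I1) = Tsep (intervene (reverseEdge E1 u v) I2) := by
  intro I hI
  by_cases hv : v ∈ I
  · obtain rfl := hI.eq_singleton_of_mem hv
    exact ⟨{u}, Set.subsingleton_singleton, by rw [hiso.intervene_head]⟩
  by_cases hu : u ∈ I
  · obtain rfl := hI.eq_singleton_of_mem hu
    exact ⟨∅, Set.subsingleton_empty,
      by rw [hiso.intervene_tail, intervene_empty, hiso.Tsep_reverseEdge]⟩
  · exact ⟨I, hI, by rw [intervene_reverseEdge hu, (hiso.intervene hv).Tsep_reverseEdge]⟩
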